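/- Let 1 → A →α B →β C → 1 be a central extension of Γ-groups and U a cover of a left Γ-set X. Let ψ ∈ K^1_Γ(U,X,B) be such that φ := β ∘ ψ satisfies the 1-cocycle condition (δ_1φ)^{−1}(δ_2φ)(δ_0φ) = 1. Then the 2-cochain ν := (δ_1ψ)^{−1}(δ_2ψ)(δ_0ψ) ∈ K^2_Γ(U,X,B) takes values in α(A), and the unique ν̄ ∈ K^2_Γ(U,X,A) with α ∘ ν̄ = ν is a 2-cocycle: ∂ν̄ = 0. -/

import Mathlib

namespace SemiDD

/-- Extend a finite tuple by `1` outside its range. -/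
def ext {G : Type*} [One G] {n : ℕ} (f : Fin n → G) (m : ℕ) : G :=
  if h : m < n then f ⟨m, h⟩ else 1

/-- The face maps `d_i : X^{p+1} → X^p` of the simplicial space `X^• = {Γ^p × X}`. -/
def face {Γ X : Type*} [Group Γ] [MulAction Γ X] {p : ℕ} (i : ℕ)
    (z : (Fin (p + 1) → Γ) × X) : (Fin p → Γ) × X :=
  (fun k => if (k : ℕ) + 1 < i then ext z.1 (k : ℕ)
    else if (k : ℕ) + 1 = i then ext z.1 (k : ℕ) * ext z.1 ((k : ℕ) + 1)
    else ext z.1 ((k : ℕ) + 1),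
   if i = p + 1 then ext z.1 p • z.2 else z.2)

/-- The degeneracy maps `e_i : X^p → X^{p+1}` of the simplicial space. -/
def degen {Γ X : Type*} [One Γ] {p : ℕ} (i : ℕ)
    (z : (Fin p → Γ) × X) : (Fin (p + 1) → Γ) × X :=
  (fun k => if (k : ℕ) < i then ext z.1 (k : ℕ)
    else if (k : ℕ) = i then 1
    else ext z.1 ((k : ℕ) - 1), z.2)

/-- The simplicial twisting maps `θ_i^{x^p} : G → G`: `θ_0^{(γ_1,…,γ_p,x)} = θ_{γ_1}`
and `θ_i = id` for `i ≥ 1`. -/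
def twist {Γ G : Type*} [Group Γ] [Group G] [MulDistribMulAction Γ G]
    {X : Type*} {p : ℕ} (i : ℕ) (z : (Fin p → Γ) × X) (g : G) : G :=
  if i = 0 then ext z.1 0 • g else g

/-- The point `x^p_i = γ_{i+1}⋯γ_p • x` associated to `x^p = (γ_1,…,γ_p,x) ∈ X^p`. -/
def pt {Γ X : Type*} [Group Γ] [MulAction Γ X] {p : ℕ}
    (z : (Fin p → Γ) × X) (i : ℕ) : X :=
  (((List.range p).drop i).map (ext z.1)).prod • z.2

/-- The subset `U_{(a_0,…,a_p)} ⊆ X^p` of the simplicial cover. -/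
def tupSet {Γ X ι : Type*} [Group Γ] [MulAction Γ X] (U : ι → Set X)
    {p : ℕ} (a : Fin (p + 1) → ι) : Set ((Fin p → Γ) × X) :=
  {z | ∀ i : Fin (p + 1), pt z (i : ℕ) ∈ U (a i)}

/-- The face map on index tuples: delete the `i`-th entry. -/
def faceIdx {ι : Type*} {n : ℕ} (i : ℕ) (a : Fin (n + 1) → ι) : Fin n → ι :=
  fun k => if (k : ℕ) < i then a k.castSucc else a k.succ

/-- The group `K^p_Γ(U,X,(G,θ))` of `p`-cochains. -/
abbrev K (Γ : Type*) {X ι : Type*} [Group Γ] [MulAction Γ X]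
    (U : ι → Set X) (G : Type*) [Group G] (p : ℕ) :=
  ∀ a : Fin (p + 1) → ι, tupSet (Γ := Γ) U a → G

open Classical in
/-- The twisted pullback maps `δ_i : K^p → K^{p+1}`. -/
noncomputable def tpb {Γ X ι G : Type*} [Group Γ] [MulAction Γ X] [Group G]
    [MulDistribMulAction Γ G] {U : ι → Set X} {p : ℕ} (i : ℕ)
    (φ : K Γ U G p) : K Γ U G (p + 1) :=
  fun a z =>
    twist i z.1
      (if h : face i z.1 ∈ tupSet (Γ := Γ) U (faceIdx i a) then
        φ (faceIdx i a) ⟨face i z.1, h⟩ else 1)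

/-- The coboundary `∂ = Σ_{i=0}^{p+1} (−1)^i δ_i : K^p → K^{p+1}` (written
multiplicatively, as an ordered product; for abelian coefficients this is the
alternating sum of the twisted pullbacks). -/
noncomputable def cob {Γ X ι G : Type*} [Group Γ] [MulAction Γ X] [Group G]
    [MulDistribMulAction Γ G] {U : ι → Set X} {p : ℕ}
    (φ : K Γ U G p) : K Γ U G (p + 1) :=
  ((List.range (p + 2)).map (fun i => tpb i φ ^ ((-1 : ℤ) ^ i))).prod

/-- The map on cochains induced by a map of coefficient groups. -/
def mapK {Γ X ι : Type*} [Group Γ] [MulAction Γ X] {U : ι → Set X}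
    {A B : Type*} [Group A] [Group B] (f : A → B) {p : ℕ}
    (φ : K Γ U A p) : K Γ U B p :=
  fun a z => f (φ a z)

/-- The restriction map on cochains induced by a refinement `r` of covers. -/
def res {Γ X ι κ G : Type*} [Group Γ] [MulAction Γ X] [Group G]
    {U : ι → Set X} {V : κ → Set X} (r : κ → ι)
    (hr : ∀ b, V b ⊆ U (r b)) {p : ℕ} (φ : K Γ U G p) : K Γ V G p :=
  fun b z => φ (fun i => r (b i)) ⟨z.1, fun i => hr (b i) (z.2 i)⟩

/-- A `Γ`-semi-equivariant (G,θ)-valued transition cocycle over the cover `U`. -/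
def IsCocycle {Γ X G ι : Type*} [Group Γ] [MulAction Γ X] [Group G]
    [MulDistribMulAction Γ G] (U : ι → Set X) (φ : ι → ι → Γ → X → G) : Prop :=
  (∀ (a : ι) (x : X), x ∈ U a → φ a a 1 x = 1) ∧
  (∀ (γ' γ : Γ) (a b c : ι) (x : X), x ∈ U a → γ • x ∈ U b →
    (γ' * γ) • x ∈ U c →
    φ c a (γ' * γ) x = φ c b γ' (γ • x) * γ' • φ b a γ x)

/-- Set-theoretic data of a `Γ`-semi-equivariant principal `(G,θ)`-bundle over
a left `Γ`-set `X`. -/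
structure SEBundle (Γ X G : Type*) [Group Γ] [MulAction Γ X] [Group G]
    [MulDistribMulAction Γ G] where
  P : Type*
  π : P → X
  surj : Function.Surjective π
  actG : P → G → P
  actG_one : ∀ p, actG p 1 = p
  actG_mul : ∀ p g g', actG (actG p g) g' = actG p (g * g')
  π_actG : ∀ p g, π (actG p g) = π p
  freeTrans : ∀ p q, π p = π q → ∃! g, actG p g = q
  actΓ : Γ → P → P
  actΓ_one : ∀ p, actΓ 1 p = p
  actΓ_mul : ∀ γ' γ p, actΓ γ' (actΓ γ p) = actΓ (γ' * γ) p
  π_actΓ : ∀ γ p, π (actΓ γ p) = γ • π p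
  semi : ∀ γ p g, actΓ γ (actG p g) = actG (actΓ γ p) (γ • g)

/-- The total space `⨆_{a} {a} × U_a × G` used in reconstructing a bundle
from a transition cocycle. -/
def Tot {X ι : Type*} (U : ι → Set X) (G : Type*) :=
  Σ a : ι, (U a) × G

/-- The gluing relation `(a,x,g) ~ (b,x,φ_{ba}(1,x)·g)`. -/
def rel {Γ X G ι : Type*} [One Γ] [Mul G] (U : ι → Set X)
    (φ : ι → ι → Γ → X → G) (z w : Tot U G) : Prop :=
  (z.2.1 : X) = (w.2.1 : X) ∧ w.2.2 = φ w.1 z.1 (1 : Γ) (z.2.1 : X) * z.2.2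

/-- The total space `P^φ` of the bundle reconstructed from a transition
cocycle `φ`. -/
def PB {Γ X G ι : Type*} [One Γ] [Mul G] (U : ι → Set X)
    (φ : ι → ι → Γ → X → G) :=
  Quot (rel U φ)

/-- The projection `π : P^φ → X`, `[a,x,g] ↦ x`. -/
def pbProj {Γ X G ι : Type*} [One Γ] [Mul G] {U : ι → Set X}
    {φ : ι → ι → Γ → X → G} : PB U φ → X :=
  Quot.lift (fun z => (z.2.1 : X)) (fun _ _ h => h.1)

/-- The right `G`-action on `P^φ`, `[a,x,g]·g' = [a,x,g·g']`. -/
def pbActG {Γ X G ι : Type*} [One Γ] [Group G] {U : ι → Set X}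
    {φ : ι → ι → Γ → X → G} (g' : G) : PB U φ → PB U φ :=
  Quot.lift (fun z => Quot.mk (rel U φ) ⟨z.1, ⟨z.2.1, z.2.2 * g'⟩⟩)
    (fun z w h => Quot.sound
      ⟨h.1, show w.2.2 * g' = φ w.1 z.1 (1 : Γ) (z.2.1 : X) * (z.2.2 * g') from
        by rw [h.2, mul_assoc]⟩)

/-- Specification of the left `Γ`-action `γ·[a,x,g] = [b, γ·x, φ_{ba}(γ,x)·(γ·g)]`
on `P^φ`. -/
def pbActSpec {Γ X G ι : Type*} [Group Γ] [MulAction Γ X] [Group G]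
    [MulDistribMulAction Γ G] (U : ι → Set X) (φ : ι → ι → Γ → X → G)
    (act : Γ → PB U φ → PB U φ) : Prop :=
  ∀ (γ : Γ) (a : ι) (x : X) (hx : x ∈ U a) (g : G) (b : ι) (hb : γ • x ∈ U b),
    act γ (Quot.mk (rel U φ) ⟨a, ⟨⟨x, hx⟩, g⟩⟩) =
      Quot.mk (rel U φ) ⟨b, ⟨⟨γ • x, hb⟩, φ b a γ x * γ • g⟩⟩

section Twist

variable {Γ X G H : Type*} [Group Γ] [Group G] [MulDistribMulAction Γ G]
  [Group H] [MulDistribMulAction Γ H] {p : ℕ}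

theorem twist_one (i : ℕ) (z : (Fin p → Γ) × X) : twist i z (1 : G) = 1 := by
  simp [twist]

theorem twist_mul (i : ℕ) (z : (Fin p → Γ) × X) (g h : G) :
    twist i z (g * h) = twist i z g * twist i z h := by
  unfold twist
  split_ifs <;> simp [smul_mul']

theorem map_twist (f : G →* H) (hf : ∀ (γ : Γ) (g : G), f (γ • g) = γ • f g) (i : ℕ)
    (z : (Fin p → Γ) × X) (g : G) : f (twist i z g) = twist i z (f g) := by
  unfold twist
  split_ifs <;> simp [hf]

end Twist

section Simplicial

variable {Γ X ι : Type*} [Group Γ] [MulAction Γ X] {U : ι → Set X} {p : ℕ}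

theorem pt_last (z : (Fin p → Γ) × X) : pt z p = z.2 := by
  simp [pt, List.drop_eq_nil_of_le]

theorem pt_of_lt (z : (Fin p → Γ) × X) {k : ℕ} (hk : k < p) :
    pt z k = ext z.1 k • pt z (k + 1) := by
  rw [pt, pt, List.drop_eq_getElem_cons (by simpa using hk)]
  simp [mul_smul]

theorem ext_face (i : ℕ) (z : (Fin (p + 1) → Γ) × X) {k : ℕ} (hk : k < p) :
    ext (face i z).1 k =
      if k + 1 < i then ext z.1 k
      else if k + 1 = i then ext z.1 k * ext z.1 (k + 1) else ext z.1 (k + 1) := by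
  have h : k < p + 1 := by omega
  simp only [ext, face, hk, h, Nat.succ_lt_succ hk, dite_true]

theorem pt_face {i : ℕ} (hi : i ≤ p + 1) (z : (Fin (p + 1) → Γ) × X) {k : ℕ} (hk : k ≤ p) :
    pt (face i z) k = pt z (if k < i then k else k + 1) := by
  induction hk using Nat.decreasingInduction with
  | self =>
    rw [pt_last]
    split_ifs with h
    · rw [pt_of_lt z (Nat.lt_succ_self p), pt_last]
      simp [face, show i = p + 1 by omega]
    · rw [pt_last]
      simp [face, show i ≠ p + 1 by omega]
  | of_succ k hk ih =>
    rw [pt_of_lt _ hk, ih, ext_face i z hk]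
    rcases lt_trichotomy (k + 1) i with h | h | h
    · rw [if_pos h, if_pos h, if_pos (by omega), pt_of_lt z (k := k) (by omega)]
    · rw [if_neg (by omega), if_pos h, if_neg (by omega), if_pos (by omega),
        pt_of_lt z (k := k) (by omega), pt_of_lt z (k := k + 1) (by omega), mul_smul]
    · rw [if_neg (by omega), if_neg (by omega), if_neg (by omega), if_neg (by omega),
        pt_of_lt z (k := k + 1) (by omega)]

theorem face_mem_tupSet {i : ℕ} (hi : i ≤ p + 1) {a : Fin (p + 2) → ι}
    {z : (Fin (p + 1) → Γ) × X} (hz : z ∈ tupSet U a) :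
    face i z ∈ tupSet U (faceIdx i a) := by
  intro k
  rw [pt_face hi z (by omega), faceIdx]
  split_ifs
  · exact hz k.castSucc
  · exact hz k.succ

theorem face_face {i j : ℕ} (hij : i ≤ j) (hj : j ≤ p + 1)
    (z : (Fin (p + 2) → Γ) × X) :
    face j (face i z) = face i (face (j + 1) z) := by
  refine Prod.ext (funext fun k => ?_) ?_
  · have hk := k.isLt
    simp only [face.eq_1 j (face i z), face.eq_1 i (face (j + 1) z)]
    rw [ext_face i z (show (k : ℕ) < p + 1 by omega),
      ext_face i z (show (k : ℕ) + 1 < p + 1 by omega),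
      ext_face (j + 1) z (show (k : ℕ) < p + 1 by omega),
      ext_face (j + 1) z (show (k : ℕ) + 1 < p + 1 by omega)]
    split_ifs <;> first | rfl | omega | exact mul_assoc _ _ _
  · simp only [face.eq_1 j (face i z), face.eq_1 i (face (j + 1) z)]
    rw [ext_face i z (Nat.lt_succ_self p), ext_face (j + 1) z (Nat.lt_succ_self p)]
    simp only [face]
    split_ifs <;> first | rfl | omega | exact mul_smul _ _ _

theorem faceIdx_faceIdx {i j : ℕ} (hij : i ≤ j) (a : Fin (p + 2) → ι) :
    faceIdx j (faceIdx i a) = faceIdx i (faceIdx (j + 1) a) := by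
  funext k
  simp only [faceIdx, Fin.val_castSucc, Fin.val_succ]
  split_ifs <;> first | rfl | omega

theorem K.apply_congr {G : Type*} [Group G] (φ : K Γ U G p) {a b : Fin (p + 1) → ι}
    {z w : (Fin p → Γ) × X}
    (hab : a = b) (hzw : z = w) (hz : z ∈ tupSet U a) (hw : w ∈ tupSet U b) :
    φ a ⟨z, hz⟩ = φ b ⟨w, hw⟩ := by
  subst hab hzw
  rfl

end Simplicial

section Pullback

variable {Γ X ι G H : Type*} [Group Γ] [MulAction Γ X] [Group G] [MulDistribMulAction Γ G]
  [Group H] [MulDistribMulAction Γ H] {U : ι → Set X} {p : ℕ}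

theorem tpb_apply {i : ℕ} (hi : i ≤ p + 1) (φ : K Γ U G p) (a : Fin (p + 2) → ι)
    (z : tupSet (Γ := Γ) U a) :
    tpb i φ a z = twist i z.1 (φ (faceIdx i a) ⟨face i z.1, face_mem_tupSet hi z.2⟩) := by
  rw [tpb, dif_pos]

/-- The cosimplicial identity for the twisted pullbacks. -/
theorem tpb_tpb {i j : ℕ} (hij : i ≤ j) (hj : j ≤ p + 1) (φ : K Γ U G p) :
    tpb i (tpb j φ) = tpb (j + 1) (tpb i φ) := by
  funext a z
  rw [tpb_apply (by omega), tpb_apply hj, tpb_apply (by omega), tpb_apply (by omega),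
    K.apply_congr φ (faceIdx_faceIdx hij a) (face_face hij hj z.1)
      _ (face_mem_tupSet (by omega) (face_mem_tupSet (by omega) z.2))]
  simp only [twist, ext_face _ _ (Nat.succ_pos p)]
  rcases i with _ | i
  · rcases j with _ | j <;> simp [mul_smul]
  · simp [show j ≠ 0 by omega]

/-- The twisted pullback as a homomorphism of cochain groups. -/
noncomputable def tpbHom (i : ℕ) : K Γ U G p →* K Γ U G (p + 1) where
  toFun := tpb i
  map_one' := by
    funext a z
    simp [tpb, twist_one]
  map_mul' φ ψ := by
    funext a z
    simp only [tpb, Pi.mul_apply, ← twist_mul]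
    split_ifs <;> simp

theorem tpb_mul (i : ℕ) (φ ψ : K Γ U G p) : tpb i (φ * ψ) = tpb i φ * tpb i ψ :=
  map_mul (tpbHom i) φ ψ

theorem tpb_inv (i : ℕ) (φ : K Γ U G p) : tpb i φ⁻¹ = (tpb i φ)⁻¹ :=
  map_inv (tpbHom i) φ

theorem mapK_tpb (f : G →* H) (hf : ∀ (γ : Γ) (g : G), f (γ • g) = γ • f g) (i : ℕ)
    (φ : K Γ U G p) : mapK f (tpb i φ) = tpb i (mapK f φ) := by
  funext a z
  simp only [mapK, tpb, map_twist f hf]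
  split_ifs <;> simp

end Pullback

theorem cob_two {Γ X ι A : Type*} [Group Γ] [MulAction Γ X] [CommGroup A]
    [MulDistribMulAction Γ A] {U : ι → Set X} (ν : K Γ U A 2) :
    cob ν = tpb 0 ν * (tpb 1 ν)⁻¹ * tpb 2 ν * (tpb 3 ν)⁻¹ := by
  simp [cob, List.range_succ, pow_succ, mul_assoc]

/-- Compatibility of the four factor-set elements attached to the faces of a tetrahedron. -/
theorem mul_eq_mul_of_tetrahedron {B : Type*} [Group B]
    {p₀₁ p₀₂ p₀₃ q₁₂ q₁₃ r n₀ n₁ n₂ n₃ : B}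
    (h₀ : n₀ = q₁₃⁻¹ * q₁₂ * r) (h₁ : n₁ = p₀₃⁻¹ * p₀₂ * r)
    (h₂ : n₂ = p₀₃⁻¹ * p₀₁ * q₁₃) (h₃ : n₃ = p₀₂⁻¹ * p₀₁ * q₁₂)
    (hcentral : ∀ b, n₃ * b = b * n₃) :
    n₂ * n₀ = n₁ * n₃ := by
  have h : n₁ * n₃ = p₀₃⁻¹ * p₀₂ * n₃ * r := by
    rw [h₁, mul_assoc _ r, ← hcentral r, ← mul_assoc]
  rw [h, h₀, h₂, h₃]
  group

/-- for a central extension of Γ-groups and a lift `ψ` of a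
1-cocycle `φ`, the 2-cochain `ν = (δ₁ψ)⁻¹(δ₂ψ)(δ₀ψ)` takes values in `α(A)`
and the corresponding `A`-valued 2-cochain is a 2-cocycle. -/
theorem statement15 {Γ X ι A B C : Type*} [Group Γ] [MulAction Γ X]
    [CommGroup A] [Group B] [Group C] [MulDistribMulAction Γ A]
    [MulDistribMulAction Γ B] [MulDistribMulAction Γ C]
    (U : ι → Set X) (α : A →* B) (β : B →* C)
    (hαΓ : ∀ (γ : Γ) (g : A), α (γ • g) = γ • α g)
    (hβΓ : ∀ (γ : Γ) (g : B), β (γ • g) = γ • β g)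
    (hαinj : Function.Injective ⇑α)
    (hcentral : ∀ (x : A) (b : B), α x * b = b * α x)
    (hβsurj : Function.Surjective ⇑β)
    (hexact : ∀ b : B, β b = 1 ↔ b ∈ Set.range ⇑α)
    (ψ : K Γ U B 1)
    (hφcoc : (tpb 1 (mapK (⇑β) ψ))⁻¹ * tpb 2 (mapK (⇑β) ψ) * tpb 0 (mapK (⇑β) ψ) = 1) :
    (∀ (a : Fin 3 → ι) (z : tupSet (Γ := Γ) U a),
      ((tpb 1 ψ)⁻¹ * tpb 2 ψ * tpb 0 ψ) a z ∈ Set.range ⇑α) ∧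
    (∀ ν : K Γ U A 2,
      mapK (⇑α) ν = (tpb 1 ψ)⁻¹ * tpb 2 ψ * tpb 0 ψ → cob ν = 1) := by
  refine ⟨fun a z => (hexact _).1 ?_, fun ν h => ?_⟩
  · rw [← mapK_tpb β hβΓ, ← mapK_tpb β hβΓ, ← mapK_tpb β hβΓ] at hφcoc
    simpa [mapK] using congrFun (congrFun hφcoc a) z
  · have hν (i : ℕ) : mapK (⇑α) (tpb i ν) =
        (tpb i (tpb 1 ψ))⁻¹ * tpb i (tpb 2 ψ) * tpb i (tpb 0 ψ) := by
      rw [mapK_tpb α hαΓ, h, tpb_mul, tpb_mul, tpb_inv]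
    funext a z
    have h₀ := congrFun (congrFun (hν 0) a) z
    have h₁ := congrFun (congrFun (hν 1) a) z
    have h₂ := congrFun (congrFun (hν 2) a) z
    have h₃ := congrFun (congrFun (hν 3) a) z
    rw [tpb_tpb (i := 0) (j := 1) (by omega) (by omega),
      tpb_tpb (i := 0) (j := 2) (by omega) (by omega)] at h₀
    rw [← tpb_tpb (i := 0) (j := 0) (by omega) (by omega),
      tpb_tpb (i := 1) (j := 1) (by omega) (by omega),
      tpb_tpb (i := 1) (j := 2) (by omega) (by omega)] at h₁
    rw [tpb_tpb (i := 2) (j := 2) (by omega) (by omega)] at h₂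
    have key := mul_eq_mul_of_tetrahedron h₀ h₁ h₂ h₃ (hcentral _)
    simp only [mapK, ← map_mul] at key
    have hface := hαinj key
    rw [cob_two]
    simp only [Pi.mul_apply, Pi.inv_apply, Pi.one_apply]
    rw [mul_inv_eq_one, mul_right_comm, mul_comm (tpb 0 ν a z), hface, mul_inv_cancel_comm]

end SemiDD
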